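/- Let R₁, R₂ : ℝ → S(E) be smooth maps with R₁(t) ≥ R₂(t) for all t ∈ ℝ. For i = 1, 2, let Sᵢ : (0, tᵢ) → S(E) be a solution of the Riccati equation Sᵢ' + Sᵢ² + Rᵢ = 0 which cannot be extended beyond tᵢ. Assume that U := S₂ − S₁ has a continuous extension to t = 0 with U(0) ≥ 0. Then the function d(t) := dim ker U(t) is monotonically nonincreasing on (0, t₁). -/

import Mathlib

open scoped RealInnerProductSpace

open Set Filter Topology

/-- Smooth truncation: a smooth map agrees on a given ball with a bounded, globally Lipschitz map
whose norm it dominates. -/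
lemma exists_lipschitzWith_bounded_eq_of_contDiff
    {X Y : Type*} [NormedAddCommGroup X] [NormedSpace ℝ X] [FiniteDimensional ℝ X]
    [NormedAddCommGroup Y] [NormedSpace ℝ Y] {g : X → Y} (hg : ContDiff ℝ 1 g) (M : ℝ) :
    ∃ (φ : X → Y) (K L : NNReal), LipschitzWith K φ ∧ (∀ x, ‖φ x‖ ≤ L) ∧
      (∀ x, ‖φ x‖ ≤ ‖g x‖) ∧ ∀ x, ‖x‖ ≤ M → φ x = g x := by
  let χ : ContDiffBump (0 : X) := ⟨max M 1, max M 1 + 1, by positivity, by linarith⟩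
  have hc : HasCompactSupport (fun x => χ x • g x) := χ.hasCompactSupport.smul_right
  have hd : ContDiff ℝ 1 (fun x => χ x • g x) := χ.contDiff.smul hg
  obtain ⟨K, hK⟩ := hd.lipschitzWith_of_hasCompactSupport hc one_ne_zero
  obtain ⟨L, hL⟩ := hc.exists_bound_of_continuous hd.continuous
  refine ⟨fun x => χ x • g x, K, L.toNNReal, hK, fun x => (hL x).trans (Real.le_coe_toNNReal L),
    fun x => ?_, fun x hx => ?_⟩
  · rw [norm_smul, Real.norm_of_nonneg χ.nonneg]
    exact mul_le_of_le_one_left (norm_nonneg _) χ.le_one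
  · have : x ∈ Metric.closedBall (0 : X) χ.rIn := by
      rw [mem_closedBall_zero_iff]
      exact hx.trans (le_max_left _ _)
    simp [χ.one_of_mem_closedBall this]

lemma HasDerivWithinAt.Ici_of_Icc {X : Type*} [NormedAddCommGroup X] [NormedSpace ℝ X]
    {f : ℝ → X} {f' : X} {a b t : ℝ} (h : HasDerivWithinAt f f' (Icc a b) t) (ht : t ∈ Ico a b) :
    HasDerivWithinAt f f' (Ici t) t :=
  h.mono_of_mem_nhdsWithin (Icc_mem_nhdsGE_of_mem ht)

/-- Global existence for a bounded, globally Lipschitz vector field. -/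
lemma exists_solution_of_bounded_lipschitz
    {X : Type*} [NormedAddCommGroup X] [NormedSpace ℝ X] [CompleteSpace X]
    {f : ℝ → X → X} {a b : ℝ} (hab : a ≤ b) {K L : NNReal}
    (hK : ∀ t ∈ Icc a b, LipschitzWith K (f t)) (hL : ∀ t ∈ Icc a b, ∀ x, ‖f t x‖ ≤ L)
    (hc : ∀ x, ContinuousOn (fun t => f t x) (Icc a b)) (x₀ : X) :
    ∃ x : ℝ → X, x a = x₀ ∧ ∀ t ∈ Icc a b, HasDerivWithinAt x (f t (x t)) (Icc a b) t := by
  have h : IsPicardLindelof f (⟨a, left_mem_Icc.2 hab⟩ : Icc a b) x₀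
      (L * (b - a).toNNReal) 0 L K :=
    { lipschitzOnWith := fun t ht => (hK t ht).lipschitzOnWith
      continuousOn := fun x _ => hc x
      norm_le := fun t ht x _ => hL t ht x
      mul_max_le := by simp [hab] }
  exact h.exists_eq_forall_mem_Icc_hasDerivWithinAt₀

/-- Global existence of the fundamental solution of a linear equation. -/
lemma exists_fundamental_solution
    {E : Type*} [NormedAddCommGroup E] [NormedSpace ℝ E] [FiniteDimensional ℝ E]
    {A : ℝ → E →L[ℝ] E} {a b : ℝ} (hab : a ≤ b) (hA : ContinuousOn A (Icc a b)) :
    ∃ H : ℝ → E →L[ℝ] E, H a = 1 ∧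
      ∀ t ∈ Icc a b, HasDerivWithinAt H (A t * H t) (Icc a b) t := by
  have : CompleteSpace (E →L[ℝ] E) := FiniteDimensional.complete ℝ _
  obtain ⟨C, hC⟩ := isCompact_Icc.exists_bound_of_continuousOn hA
  have hC0 : 0 ≤ C := (norm_nonneg _).trans (hC a (left_mem_Icc.2 hab))
  lift C to NNReal using hC0
  obtain ⟨φ, K, L, hK, hL, hφ, hφ'⟩ := exists_lipschitzWith_bounded_eq_of_contDiff
    (g := fun x : E →L[ℝ] E => x) contDiff_id
    (‖(1 : E →L[ℝ] E)‖ * Real.exp (C * (b - a)))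
  obtain ⟨H, H0, hH⟩ := exists_solution_of_bounded_lipschitz (f := fun t x => A t * φ x)
    (K := C * K) (L := C * L) hab
    (fun t ht => LipschitzWith.of_dist_le_mul fun x y => by
      rw [dist_eq_norm, ← mul_sub, NNReal.coe_mul, mul_assoc]
      refine (norm_mul_le _ _).trans (mul_le_mul (hC t ht) ?_ (norm_nonneg _) C.2)
      simpa [dist_eq_norm] using hK.dist_le_mul x y)
    (fun t ht x => (norm_mul_le _ _).trans (by
      push_cast
      exact mul_le_mul (hC t ht) (hL x) (norm_nonneg _) C.2))
    (fun x => hA.mul continuousOn_const) 1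
  have hbound := norm_le_gronwallBound_of_norm_deriv_right_le (K := C) (ε := 0)
    (fun t ht => (hH t ht).continuousWithinAt)
    (fun t ht => (hH t (Ico_subset_Icc_self ht)).Ici_of_Icc ht) (congrArg norm H0).le
    (fun t ht => (norm_mul_le _ _).trans (by
      rw [add_zero]
      exact mul_le_mul (hC t (Ico_subset_Icc_self ht)) (hφ _) (norm_nonneg _) C.2))
  refine ⟨H, H0, fun t ht => ?_⟩
  have := hH t ht
  rwa [hφ' (H t)] at this
  refine (hbound t ht).trans ?_
  rw [gronwallBound_ε0]
  gcongr
  exact ht.2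

lemma le_of_hasDerivWithinAt_nonneg {f f' : ℝ → ℝ} {a b : ℝ} (hab : a ≤ b)
    (hf : ∀ t ∈ Icc a b, HasDerivWithinAt f (f' t) (Icc a b) t)
    (hf' : ∀ t ∈ Icc a b, 0 ≤ f' t) : f a ≤ f b :=
  monotoneOn_of_hasDerivWithinAt_nonneg (convex_Icc a b)
    (fun t ht => (hf t ht).continuousWithinAt)
    (fun t ht => (hf t (interior_subset ht)).mono interior_subset)
    (fun t ht => hf' t (interior_subset ht)) (left_mem_Icc.2 hab) (right_mem_Icc.2 hab) hab

section Riccati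

variable {E : Type*} [NormedAddCommGroup E] [InnerProductSpace ℝ E]

lemma abs_inner_apply_self_le (T : E →L[ℝ] E) (v : E) : |⟪T v, v⟫| ≤ ‖T‖ * ‖v‖ ^ 2 := by
  refine (abs_real_inner_le_norm _ _).trans ?_
  rw [pow_two, ← mul_assoc]
  gcongr
  exact T.le_opNorm v

variable [FiniteDimensional ℝ E]

lemma IsSelfAdjoint.inner_comm_apply {T : E →L[ℝ] E} (hT : IsSelfAdjoint T) (x y : E) :
    ⟪T x, y⟫ = ⟪x, T y⟫ :=
  hT.isSymmetric x y

lemma IsSelfAdjoint.norm_le_of_abs_inner_le {T : E →L[ℝ] E} (hT : IsSelfAdjoint T) {N : ℝ}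
    (hN : 0 ≤ N) (h : ∀ v, |⟪T v, v⟫| ≤ N * ‖v‖ ^ 2) : ‖T‖ ≤ N := by
  rw [T.norm_eq_iSup_rayleighQuotient hT.isSymmetric]
  refine ciSup_le fun v => ?_
  rw [ContinuousLinearMap.rayleighQuotient, abs_div, abs_of_nonneg (sq_nonneg ‖v‖)]
  exact div_le_of_le_mul₀ (sq_nonneg _) hN (h v)

/-- A nonnegative self-adjoint operator annihilates the zeros of its quadratic form. -/
lemma IsSelfAdjoint.apply_eq_zero_of_inner_eq_zero {T : E →L[ℝ] E} (hT : IsSelfAdjoint T)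
    (hpos : ∀ v, 0 ≤ ⟪T v, v⟫) {v : E} (hv : ⟪T v, v⟫ = 0) : T v = 0 := by
  have key : ∀ s : ℝ, 0 ≤ ⟪T (T v), T v⟫ * (s * s) + (2 * ⟪T v, T v⟫) * s + 0 := by
    intro s
    have h := hpos (v + s • T v)
    simp only [map_add, map_smul, inner_add_left, inner_add_right, inner_smul_left,
      inner_smul_right, hv, hT.inner_comm_apply (T v) v, RCLike.conj_to_real] at h
    linarith
  have hd := discrim_le_zero key
  rw [discrim] at hd
  have : ⟪T v, T v⟫ = 0 := by nlinarith
  exact inner_self_eq_zero.1 this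

/-- One-sided growth estimate for Riccati solutions. -/
lemma riccati_inner_le {S R : ℝ → E →L[ℝ] E} {a b C : ℝ} (hab : a ≤ b)
    (hsa : ∀ t ∈ Icc a b, IsSelfAdjoint (S t))
    (hS : ∀ t ∈ Icc a b, HasDerivAt S (-(S t * S t) - R t) t)
    (hC : ∀ t ∈ Icc a b, ‖R t‖ ≤ C) (v : E) :
    ⟪S b v, v⟫ ≤ ⟪S a v, v⟫ + C * (b - a) * ‖v‖ ^ 2 := by
  have h := le_of_hasDerivWithinAt_nonneg (f := fun t => C * t * ‖v‖ ^ 2 - ⟪S t v, v⟫)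
    (f' := fun t => C * 1 * ‖v‖ ^ 2 - ⟪(-(S t * S t) - R t) v, v⟫) hab
    (fun t ht => by
      have h1 := (hS t ht).hasDerivWithinAt (s := Icc a b)
      have h2 := (h1.clm_apply (hasDerivWithinAt_const t _ v)).inner ℝ
        (hasDerivWithinAt_const t _ v)
      simp only [map_zero, add_zero, inner_zero_right, zero_add] at h2
      exact ((((hasDerivAt_id t).const_mul C).mul_const _).hasDerivWithinAt).sub h2)
    (fun t ht => by
      have h1 := abs_le.1 (abs_inner_apply_self_le (R t) v)
      have h2 : ‖R t‖ * ‖v‖ ^ 2 ≤ C * ‖v‖ ^ 2 := by gcongr; exact hC t ht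
      have h3 : 0 ≤ ⟪S t v, S t v⟫ := real_inner_self_nonneg
      simp only [sub_apply, neg_apply, mul_apply_eq_comp, inner_sub_left,
        inner_neg_left, (hsa t ht).inner_comm_apply (S t v) v]
      linarith)
  linarith

/-- Transport along `h' = ½ (S₁ + S₂) h`: the quadratic form of `S₂ - S₁` does not decrease, and
lengths contract at a controlled rate. -/
lemma exists_riccati_transport {S₁ S₂ R₁ R₂ : ℝ → E →L[ℝ] E} {a b c : ℝ} (hab : a ≤ b)
    (hR : ∀ t ∈ Icc a b, ∀ v, 0 ≤ ⟪(R₁ t - R₂ t) v, v⟫)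
    (hsa₁ : ∀ t ∈ Icc a b, IsSelfAdjoint (S₁ t)) (hsa₂ : ∀ t ∈ Icc a b, IsSelfAdjoint (S₂ t))
    (hS₁ : ∀ t ∈ Icc a b, HasDerivAt S₁ (-(S₁ t * S₁ t) - R₁ t) t)
    (hS₂ : ∀ t ∈ Icc a b, HasDerivAt S₂ (-(S₂ t * S₂ t) - R₂ t) t)
    (hc : ∀ t ∈ Icc a b, ∀ v, -(c * ‖v‖ ^ 2) ≤ ⟪S₁ t v, v⟫ + ⟪S₂ t v, v⟫) :
    ∃ H : E →L[ℝ] E, Function.Bijective H ∧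
      (∀ v, ⟪(S₂ a - S₁ a) v, v⟫ ≤ ⟪(S₂ b - S₁ b) (H v), H v⟫) ∧
      ∀ v, ‖v‖ ^ 2 ≤ Real.exp (c * (b - a)) * ‖H v‖ ^ 2 := by
  obtain ⟨H, H0, hH⟩ := exists_fundamental_solution
    (A := fun t => (1 / 2 : ℝ) • (S₁ t + S₂ t)) hab
    (fun t ht => (((hS₁ t ht).continuousAt.add
      (hS₂ t ht).continuousAt).const_smul (1 / 2 : ℝ)).continuousWithinAt)
  have hHv : ∀ v, ∀ t ∈ Icc a b, HasDerivWithinAt (fun t => H t v)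
      ((1 / 2 : ℝ) • (S₁ t (H t v) + S₂ t (H t v))) (Icc a b) t := by
    intro v t ht
    simpa using (hH t ht).clm_apply (hasDerivWithinAt_const t _ v)
  have hnorm : ∀ v, ‖v‖ ^ 2 ≤ Real.exp (c * (b - a)) * ‖H b v‖ ^ 2 := by
    intro v
    have h := le_of_hasDerivWithinAt_nonneg (f := fun t => Real.exp (c * (t - a)) * ⟪H t v, H t v⟫)
      hab
      (fun t ht => by
        have h1 : HasDerivAt (fun t => Real.exp (c * (t - a)))
            (Real.exp (c * (t - a)) * (c * 1)) t :=
          (((hasDerivAt_id t).sub_const a).const_mul c).exp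
        exact h1.hasDerivWithinAt.mul ((hHv v t ht).inner ℝ (hHv v t ht)))
      (fun t ht => by
        have h1 := hc t ht (H t v)
        rw [← real_inner_self_eq_norm_sq] at h1
        simp only [inner_smul_right, inner_add_right, inner_smul_left, inner_add_left,
          RCLike.conj_to_real, real_inner_comm (S₁ t (H t v)), real_inner_comm (S₂ t (H t v))]
        rw [mul_assoc, ← mul_add]
        refine mul_nonneg (Real.exp_pos _).le ?_
        simp only [real_inner_comm (H t v)] at h1 ⊢
        linarith)
    simpa [H0, real_inner_self_eq_norm_sq] using h
  have hinj : Function.Injective (H b) := by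
    refine (injective_iff_map_eq_zero (H b)).2 fun v hv => ?_
    have := hnorm v
    rw [hv] at this
    simpa using this
  refine ⟨H b, ⟨hinj, (LinearMap.injective_iff_surjective (f := (H b : E →ₗ[ℝ] E))).1 hinj⟩,
    fun v => ?_, hnorm⟩
  have h := le_of_hasDerivWithinAt_nonneg (f := fun t => ⟪(S₂ t - S₁ t) (H t v), H t v⟫) hab
    (fun t ht => ((((hS₂ t ht).sub (hS₁ t ht)).hasDerivWithinAt.clm_apply (hHv v t ht)).inner ℝ
      (hHv v t ht)))
    (fun t ht => by
      have h1 := hR t ht (H t v)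
      have s1 := (hsa₁ t ht).inner_comm_apply
      have s2 := (hsa₂ t ht).inner_comm_apply
      generalize H t v = w at *
      simp only [sub_apply, neg_apply, mul_apply_eq_comp, Pi.sub_apply, map_add, map_smul,
        inner_sub_left, inner_neg_left, inner_add_left, inner_add_right, inner_smul_left,
        inner_smul_right, RCLike.conj_to_real, s1 (S₁ t w), s1 (S₂ t w),
        s2 (S₁ t w), s2 (S₂ t w)] at h1 ⊢
      have := real_inner_comm (S₁ t w) (S₂ t w)
      linarith)
  simpa [H0] using h

/-- A bounded Riccati solution on `(0, T)` extends beyond `T`. -/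
lemma exists_riccati_extension {S R : ℝ → E →L[ℝ] E} {c T N : ℝ} (hc : 0 < c) (hcT : c < T)
    (hR : Continuous R) (hRsa : ∀ t, IsSelfAdjoint (R t))
    (hsa : ∀ t ∈ Ioo 0 T, IsSelfAdjoint (S t))
    (hS : ∀ t ∈ Ioo 0 T, HasDerivAt S (-(S t * S t) - R t) t)
    (hN : ∀ t ∈ Ico c T, ‖S t‖ ≤ N) :
    ∃ T' > T, ∃ S' : ℝ → E →L[ℝ] E, (∀ t ∈ Ioo 0 T', IsSelfAdjoint (S' t)) ∧
      (∀ t ∈ Ioo 0 T', HasDerivAt S' (-(S' t * S' t) - R t) t) ∧ ∀ t ∈ Ioo 0 T, S' t = S t := by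
  have : CompleteSpace (E →L[ℝ] E) := FiniteDimensional.complete ℝ _
  obtain ⟨C, hC⟩ := (isCompact_Icc (a := c) (b := T + 1)).exists_bound_of_continuousOn
    hR.continuousOn
  have hC0 : 0 ≤ C := (norm_nonneg _).trans (hC c ⟨le_rfl, by linarith⟩)
  lift C to NNReal using hC0
  obtain ⟨ψ, K, L, hK, hL, -, hψ⟩ := exists_lipschitzWith_bounded_eq_of_contDiff
    (g := fun x : E →L[ℝ] E => x * x) (contDiff_id.mul contDiff_id) (N + 1)
  obtain ⟨Y, Y0, hY⟩ := exists_solution_of_bounded_lipschitz (f := fun t x => -ψ x - R t)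
    (a := c) (b := T + 1) (K := K) (L := L + C) (by linarith)
    (fun t _ => LipschitzWith.of_dist_le_mul fun x y => by
      simpa using hK.dist_le_mul x y)
    (fun t ht x => (norm_sub_le _ _).trans (by
      push_cast
      rw [norm_neg]
      exact add_le_add (hL x) (hC t ht)))
    (fun x => continuousOn_const.sub hR.continuousOn) (S c)
  have hYc : ContinuousOn Y (Icc c (T + 1)) := fun t ht => (hY t ht).continuousWithinAt
  have hYS : ∀ t ∈ Ico c T, Y t = S t := by
    intro τ hτ
    have hsub : Icc c τ ⊆ Icc c (T + 1) := Icc_subset_Icc_right (by linarith [hτ.2])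
    have hS' : ∀ t ∈ Icc c τ, HasDerivAt S (-(S t * S t) - R t) t := fun t ht =>
      hS t ⟨hc.trans_le ht.1, ht.2.trans_lt hτ.2⟩
    have := eq_zero_of_abs_deriv_le_mul_abs_self_of_eq_zero_right (f := fun t => Y t - S t)
      (K := K) (a := c) (b := τ)
      (fun t ht => ((hYc.mono hsub) t ht).sub (hS' t ht).continuousAt.continuousWithinAt)
      (fun t ht => (((hY t (hsub (Ico_subset_Icc_self ht))).mono hsub).Ici_of_Icc ht).sub
        (hS' t (Ico_subset_Icc_self ht)).hasDerivWithinAt)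
      (by simp [Y0])
      (fun t ht => by
        rw [← hψ (S t) ((hN t ⟨ht.1, ht.2.trans hτ.2⟩).trans (by linarith)),
          show -ψ (Y t) - R t - (-ψ (S t) - R t) = ψ (S t) - ψ (Y t) by abel]
        simpa [dist_eq_norm, norm_sub_rev] using hK.dist_le_mul (S t) (Y t))
      τ (right_mem_Icc.2 hτ.1)
    exact sub_eq_zero.1 this
  have hTmem : T ∈ Ioo c (T + 1) := ⟨hcT, by linarith⟩
  have hYcT : ContinuousAt Y T := hYc.continuousAt (Icc_mem_nhds hTmem.1 hTmem.2)
  have hYT : ‖Y T‖ ≤ N := by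
    refine le_of_tendsto (hYcT.norm.tendsto.mono_left (nhdsWithin_le_nhds (s := Iio T))) ?_
    filter_upwards [Ico_mem_nhdsLT hcT] with t ht
    rw [hYS t ht]
    exact hN t ht
  obtain ⟨δ, hδ, hδY⟩ : ∃ δ > 0, ∀ t, |t - T| < δ → ‖Y t‖ < N + 1 := by
    have := hYcT.norm.eventually_lt_const (show ‖Y T‖ < N + 1 by linarith)
    simpa [Metric.eventually_nhds_iff, Real.dist_eq] using this
  have hYN : ∀ t ∈ Ico c (T + min δ 1), ‖Y t‖ ≤ N + 1 := by
    intro t ht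
    rcases lt_or_ge t T with h | h
    · rw [hYS t ⟨ht.1, h⟩]
      exact (hN t ⟨ht.1, h⟩).trans (by linarith)
    · refine (hδY t ?_).le
      rw [abs_of_nonneg (by linarith)]
      linarith [ht.2, min_le_left δ 1]
  have hYd : ∀ t ∈ Ico c (T + min δ 1),
      HasDerivWithinAt Y (-(Y t * Y t) - R t) (Icc c (T + 1)) t := by
    intro t ht
    have := hY t ⟨ht.1, ht.2.le.trans (by linarith [min_le_right δ 1])⟩
    rwa [hψ _ (hYN t ht)] at this
  have hYsa : ∀ t ∈ Ico c (T + min δ 1), IsSelfAdjoint (Y t) := by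
    intro τ hτ
    have hsub : Icc c τ ⊆ Icc c (T + 1) :=
      Icc_subset_Icc_right (hτ.2.le.trans (by linarith [min_le_right δ 1]))
    have hd : ∀ t ∈ Ico c τ, HasDerivWithinAt Y (-(Y t * Y t) - R t) (Ici t) t := fun t ht =>
      ((hYd t ⟨ht.1, ht.2.trans hτ.2⟩).mono hsub).Ici_of_Icc ht
    have := eq_zero_of_abs_deriv_le_mul_abs_self_of_eq_zero_right (f := fun t => star (Y t) - Y t)
      (K := 2 * (N + 1)) (a := c) (b := τ)
      ((hYc.mono hsub).star.sub (hYc.mono hsub))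
      (fun t ht => (hd t ht).star.sub (hd t ht))
      (by
        rw [Y0, (hsa c ⟨hc, hcT⟩).star_eq, sub_self])
      (fun t ht => by
        have hb := hYN t ⟨ht.1, ht.2.trans hτ.2⟩
        rw [show star (-(Y t * Y t) - R t) - (-(Y t * Y t) - R t)
            = -(star (Y t) * (star (Y t) - Y t) + (star (Y t) - Y t) * Y t) by
          rw [star_sub, star_neg, star_mul, (hRsa t).star_eq]
          noncomm_ring, norm_neg, two_mul, add_mul]
        refine (norm_add_le _ _).trans (add_le_add ?_ ?_)
        · refine (norm_mul_le _ _).trans ?_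
          exact mul_le_mul_of_nonneg_right
            ((ContinuousLinearMap.adjoint.norm_map (Y t)).trans_le hb) (norm_nonneg _)
        · refine (norm_mul_le _ _).trans ?_
          rw [mul_comm]
          gcongr)
      τ (right_mem_Icc.2 hτ.1)
    exact sub_eq_zero.1 this
  classical
  refine ⟨T + min δ 1, by linarith [lt_min hδ one_pos], fun t => if t < T then S t else Y t,
    fun t ht => ?_, fun t ht => ?_, fun t ht => if_pos ht.2⟩
  · simp only
    split_ifs with h
    · exact hsa t ⟨ht.1, h⟩
    · exact hYsa t ⟨by linarith, ht.2⟩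
  · rcases lt_or_ge t T with h | h
    · simp only [if_pos h]
      refine (hS t ⟨ht.1, h⟩).congr_of_eventuallyEq ?_
      filter_upwards [Iio_mem_nhds h] with s hs
      exact if_pos hs
    · simp only [if_neg h.not_gt]
      have hcd : c < t := hcT.trans_le h
      refine ((hYd t ⟨hcd.le, ht.2⟩).hasDerivAt (Icc_mem_nhds hcd
        (ht.2.trans_le (by linarith [min_le_right δ 1])))).congr_of_eventuallyEq ?_
      filter_upwards [Ioi_mem_nhds hcd] with s hs
      split_ifs with h'
      · exact (hYS s ⟨le_of_lt hs, h'⟩).symm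
      · rfl

/-- Riccati solutions on `(0, T)` are uniformly bounded below on `(0, t]`. -/
lemma exists_riccati_lower_bound {S R : ℝ → E →L[ℝ] E} {T t : ℝ} (ht : t ∈ Ioo 0 T)
    (hR : Continuous R) (hsa : ∀ t ∈ Ioo 0 T, IsSelfAdjoint (S t))
    (hS : ∀ t ∈ Ioo 0 T, HasDerivAt S (-(S t * S t) - R t) t) :
    ∃ c, 0 ≤ c ∧ ∀ s ∈ Ioc 0 t, ∀ v, -(c * ‖v‖ ^ 2) ≤ ⟪S s v, v⟫ := by
  obtain ⟨C, hC⟩ := (isCompact_Icc (a := 0) (b := t)).exists_bound_of_continuousOn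
    hR.continuousOn
  have hC0 : 0 ≤ C := (norm_nonneg _).trans (hC 0 ⟨le_rfl, ht.1.le⟩)
  refine ⟨‖S t‖ + C * t, add_nonneg (norm_nonneg _) (mul_nonneg hC0 ht.1.le), fun s hs v => ?_⟩
  have hsub : ∀ r ∈ Icc s t, r ∈ Ioo 0 T := fun r hr => ⟨hs.1.trans_le hr.1, hr.2.trans_lt ht.2⟩
  have h := riccati_inner_le hs.2 (fun r hr => hsa r (hsub r hr)) (fun r hr => hS r (hsub r hr))
    (fun r hr => hC r ⟨hs.1.le.trans hr.1, hr.2⟩) v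
  have h1 := abs_le.1 (abs_inner_apply_self_le (S t) v)
  have h2 : C * (t - s) * ‖v‖ ^ 2 ≤ C * t * ‖v‖ ^ 2 := by
    gcongr
    linarith [hs.1]
  linarith [h1.1]

/-- Riccati comparison: `S₂ - S₁` stays nonnegative. -/
lemma riccati_sub_nonneg {S₁ S₂ R₁ R₂ : ℝ → E →L[ℝ] E} {T : ℝ}
    (hR₁ : Continuous R₁) (hR₂ : Continuous R₂)
    (hR : ∀ t v, 0 ≤ ⟪(R₁ t - R₂ t) v, v⟫)
    (hsa₁ : ∀ t ∈ Ioo 0 T, IsSelfAdjoint (S₁ t)) (hsa₂ : ∀ t ∈ Ioo 0 T, IsSelfAdjoint (S₂ t))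
    (hS₁ : ∀ t ∈ Ioo 0 T, HasDerivAt S₁ (-(S₁ t * S₁ t) - R₁ t) t)
    (hS₂ : ∀ t ∈ Ioo 0 T, HasDerivAt S₂ (-(S₂ t * S₂ t) - R₂ t) t)
    {U₀ : E →L[ℝ] E} (hU : Tendsto (fun t => S₂ t - S₁ t) (𝓝[Ioo 0 T] 0) (𝓝 U₀))
    (hU₀ : ∀ v, 0 ≤ ⟪U₀ v, v⟫) {t : ℝ} (ht : t ∈ Ioo 0 T) (w : E) :
    0 ≤ ⟪(S₂ t - S₁ t) w, w⟫ := by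
  obtain ⟨c₁, hc₁, hb₁⟩ := exists_riccati_lower_bound ht hR₁ hsa₁ hS₁
  obtain ⟨c₂, hc₂, hb₂⟩ := exists_riccati_lower_bound ht hR₂ hsa₂ hS₂
  have hlim : Tendsto (fun s => -(‖S₂ s - S₁ s - U₀‖ * (Real.exp ((c₁ + c₂) * t) * ‖w‖ ^ 2)))
      (𝓝[Ioo 0 T] 0) (𝓝 0) := by
    simpa using ((hU.sub_const U₀).norm.mul_const (Real.exp ((c₁ + c₂) * t) * ‖w‖ ^ 2)).neg
  have : (𝓝[Ioo 0 T] (0 : ℝ)).NeBot := left_nhdsWithin_Ioo_neBot (ht.1.trans ht.2)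
  refine le_of_tendsto hlim ?_
  filter_upwards [self_mem_nhdsWithin, mem_nhdsWithin_of_mem_nhds (Iio_mem_nhds ht.1)]
    with s hs hst
  have hst : s < t := hst
  have hsub : ∀ r ∈ Icc s t, r ∈ Ioo 0 T := fun r hr => ⟨hs.1.trans_le hr.1, hr.2.trans_lt ht.2⟩
  obtain ⟨H, hH, hmono, hnorm⟩ := exists_riccati_transport (c := c₁ + c₂) hst.le (fun r _ => hR r)
    (fun r hr => hsa₁ r (hsub r hr)) (fun r hr => hsa₂ r (hsub r hr))
    (fun r hr => hS₁ r (hsub r hr)) (fun r hr => hS₂ r (hsub r hr))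
    (fun r hr v => by
      linarith [hb₁ r ⟨hs.1.trans_le hr.1, hr.2⟩ v, hb₂ r ⟨hs.1.trans_le hr.1, hr.2⟩ v])
  obtain ⟨v, rfl⟩ := hH.2 w
  refine le_trans ?_ (hmono v)
  have h1 := (abs_le.1 (abs_inner_apply_self_le (S₂ s - S₁ s - U₀) v)).1
  rw [sub_apply, inner_sub_left] at h1
  have h2 : ‖v‖ ^ 2 ≤ Real.exp ((c₁ + c₂) * t) * ‖H v‖ ^ 2 := by
    refine (hnorm v).trans ?_
    gcongr
    linarith [hs.1]
  have h3 := mul_le_mul_of_nonneg_left h2 (norm_nonneg (S₂ s - S₁ s - U₀))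
  linarith [hU₀ v]

/-- A Riccati solution that dominates, on its whole interval of existence, a solution living
longer extends further. -/
lemma exists_riccati_extension_of_le {S₁ S₂ R : ℝ → E →L[ℝ] E} {T T₁ : ℝ} (hT : 0 < T)
    (hTT₁ : T < T₁) (hR : Continuous R) (hRsa : ∀ t, IsSelfAdjoint (R t))
    (hS₁ : ContinuousOn S₁ (Ioo 0 T₁))
    (hsa₂ : ∀ t ∈ Ioo 0 T, IsSelfAdjoint (S₂ t))
    (hS₂ : ∀ t ∈ Ioo 0 T, HasDerivAt S₂ (-(S₂ t * S₂ t) - R t) t)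
    (hle : ∀ t ∈ Ioo 0 T, ∀ v, 0 ≤ ⟪(S₂ t - S₁ t) v, v⟫) :
    ∃ T' > T, ∃ S' : ℝ → E →L[ℝ] E, (∀ t ∈ Ioo 0 T', IsSelfAdjoint (S' t)) ∧
      (∀ t ∈ Ioo 0 T', HasDerivAt S' (-(S' t * S' t) - R t) t) ∧ ∀ t ∈ Ioo 0 T, S' t = S₂ t := by
  obtain ⟨N, hN⟩ := (isCompact_Icc (a := T / 2) (b := T)).exists_bound_of_continuousOn
    (hS₁.mono fun t ht => ⟨by linarith [ht.1], ht.2.trans_lt hTT₁⟩)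
  obtain ⟨C, hC⟩ := (isCompact_Icc (a := T / 2) (b := T)).exists_bound_of_continuousOn
    hR.continuousOn
  have hN0 : 0 ≤ N := (norm_nonneg _).trans (hN T ⟨by linarith, le_rfl⟩)
  have hC0 : 0 ≤ C := (norm_nonneg _).trans (hC T ⟨by linarith, le_rfl⟩)
  have hM0 : 0 ≤ ‖S₂ (T / 2)‖ + C * T := by positivity
  refine exists_riccati_extension (c := T / 2) (N := N + (‖S₂ (T / 2)‖ + C * T)) (by linarith)
    (by linarith) hR hRsa hsa₂ hS₂ fun t ht => ?_
  have hsub : ∀ r ∈ Icc (T / 2) t, r ∈ Ioo 0 T := fun r hr =>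
    ⟨by linarith [hr.1], hr.2.trans_lt ht.2⟩
  have ht' := hsub t ⟨ht.1, le_rfl⟩
  refine (hsa₂ t ht').norm_le_of_abs_inner_le (by positivity) fun v => ?_
  have h1 := riccati_inner_le ht.1 (fun r hr => hsa₂ r (hsub r hr)) (fun r hr => hS₂ r (hsub r hr))
    (fun r hr => hC r ⟨hr.1, hr.2.trans ht.2.le⟩) v
  have h2 := (abs_le.1 (abs_inner_apply_self_le (S₂ (T / 2)) v)).2
  have h3 := (abs_le.1 (abs_inner_apply_self_le (S₁ t) v)).1
  have h4 : ‖S₁ t‖ * ‖v‖ ^ 2 ≤ N * ‖v‖ ^ 2 := by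
    gcongr
    exact hN t ⟨ht.1, ht.2.le⟩
  have h5 := hle t ht' v
  rw [sub_apply, inner_sub_left] at h5
  have h6 : C * (t - T / 2) * ‖v‖ ^ 2 ≤ C * T * ‖v‖ ^ 2 := by
    gcongr
    linarith [ht.2]
  have h7 := mul_nonneg hM0 (sq_nonneg ‖v‖)
  have h8 := mul_nonneg hN0 (sq_nonneg ‖v‖)
  rw [abs_le]
  constructor <;> linarith

end Riccati

/-- **Riccati comparison (Eschenburg–Heintze), part 2.**
`E` is a finite-dimensional real inner product space; endomorphisms are modelled as
continuous linear maps `E →L[ℝ] E` (all linear maps are continuous in finite dimension).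
`R₁, R₂ : ℝ → S(E)` are smooth with `R₁ ≥ R₂`; for `i = 1, 2`, `Sᵢ` is a self-adjoint
solution of `Sᵢ' + Sᵢ² + Rᵢ = 0` on `(0, tᵢ)` which cannot be extended beyond `tᵢ`;
`U = S₂ - S₁` extends continuously to `t = 0` with `U(0) ≥ 0`.
Then `d(t) = dim ker U(t)` is monotonically nonincreasing on `(0, t₁)`. -/
theorem riccati_comparison_kernel_dim
    {E : Type*} [NormedAddCommGroup E] [InnerProductSpace ℝ E] [FiniteDimensional ℝ E]
    (t₁ t₂ : ℝ) (ht₁ : 0 < t₁) (ht₂ : 0 < t₂)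
    (R₁ R₂ : ℝ → E →L[ℝ] E)
    (hR₁smooth : ContDiff ℝ (⊤ : ℕ∞) R₁) (hR₂smooth : ContDiff ℝ (⊤ : ℕ∞) R₂)
    (hR₁sa : ∀ t : ℝ, IsSelfAdjoint (R₁ t)) (hR₂sa : ∀ t : ℝ, IsSelfAdjoint (R₂ t))
    (hR₁₂ : ∀ t : ℝ, ∀ v : E, 0 ≤ ⟪(R₁ t - R₂ t) v, v⟫)
    (S₁ S₂ : ℝ → E →L[ℝ] E)
    (hS₁sa : ∀ t ∈ Set.Ioo (0 : ℝ) t₁, IsSelfAdjoint (S₁ t))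
    (hS₂sa : ∀ t ∈ Set.Ioo (0 : ℝ) t₂, IsSelfAdjoint (S₂ t))
    (hS₁ : ∀ t ∈ Set.Ioo (0 : ℝ) t₁, HasDerivAt S₁ (-(S₁ t * S₁ t) - R₁ t) t)
    (hS₂ : ∀ t ∈ Set.Ioo (0 : ℝ) t₂, HasDerivAt S₂ (-(S₂ t * S₂ t) - R₂ t) t)
    (hmax₁ : ∀ t' > t₁, ¬ ∃ S : ℝ → E →L[ℝ] E,
      (∀ t ∈ Set.Ioo (0 : ℝ) t', IsSelfAdjoint (S t)) ∧
      (∀ t ∈ Set.Ioo (0 : ℝ) t', HasDerivAt S (-(S t * S t) - R₁ t) t) ∧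
      (∀ t ∈ Set.Ioo (0 : ℝ) t₁, S t = S₁ t))
    (hmax₂ : ∀ t' > t₂, ¬ ∃ S : ℝ → E →L[ℝ] E,
      (∀ t ∈ Set.Ioo (0 : ℝ) t', IsSelfAdjoint (S t)) ∧
      (∀ t ∈ Set.Ioo (0 : ℝ) t', HasDerivAt S (-(S t * S t) - R₂ t) t) ∧
      (∀ t ∈ Set.Ioo (0 : ℝ) t₂, S t = S₂ t))
    (U₀ : E →L[ℝ] E)
    (hUcont : Filter.Tendsto (fun t => S₂ t - S₁ t)
      (nhdsWithin 0 (Set.Ioo 0 (min t₁ t₂))) (nhds U₀))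
    (hU₀ : ∀ v : E, 0 ≤ ⟪U₀ v, v⟫) :
    AntitoneOn (fun t => Module.finrank ℝ ↥(LinearMap.ker ((S₂ t - S₁ t : E →L[ℝ] E) : E →ₗ[ℝ] E)))
      (Set.Ioo (0 : ℝ) t₁) := by
  have hR₁ := hR₁smooth.continuous
  have hR₂ := hR₂smooth.continuous
  have hl : ∀ t ∈ Set.Ioo 0 (min t₁ t₂), t ∈ Set.Ioo 0 t₁ := fun t ht =>
    ⟨ht.1, ht.2.trans_le (min_le_left _ _)⟩
  have hr : ∀ t ∈ Set.Ioo 0 (min t₁ t₂), t ∈ Set.Ioo 0 t₂ := fun t ht =>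
    ⟨ht.1, ht.2.trans_le (min_le_right _ _)⟩
  have hpos : ∀ t ∈ Set.Ioo 0 (min t₁ t₂), ∀ v, 0 ≤ ⟪(S₂ t - S₁ t) v, v⟫ := fun t ht v =>
    riccati_sub_nonneg hR₁ hR₂ hR₁₂ (fun t ht => hS₁sa t (hl t ht)) (fun t ht => hS₂sa t (hr t ht))
      (fun t ht => hS₁ t (hl t ht)) (fun t ht => hS₂ t (hr t ht)) hUcont hU₀ ht v
  have ht₁₂ : t₁ ≤ t₂ := by
    by_contra! hlt
    rw [min_eq_right hlt.le] at hpos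
    obtain ⟨t', ht', S, hS⟩ := exists_riccati_extension_of_le ht₂ hlt hR₂ hR₂sa
      (fun t ht => (hS₁ t ht).continuousAt.continuousWithinAt) hS₂sa hS₂ hpos
    exact hmax₂ t' ht' ⟨S, hS⟩
  rw [min_eq_left ht₁₂] at hpos hr
  intro s hs t ht hst
  have hsub : ∀ r ∈ Set.Icc s t, r ∈ Set.Ioo 0 t₁ := fun r hr =>
    ⟨hs.1.trans_le hr.1, hr.2.trans_lt ht.2⟩
  obtain ⟨c₁, -, hb₁⟩ := exists_riccati_lower_bound ht hR₁ hS₁sa hS₁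
  obtain ⟨c₂, -, hb₂⟩ := exists_riccati_lower_bound (hr t ht) hR₂ hS₂sa hS₂
  obtain ⟨H, hH, hmono, -⟩ := exists_riccati_transport (c := c₁ + c₂) hst (fun r _ => hR₁₂ r)
    (fun r hr' => hS₁sa r (hsub r hr')) (fun r hr' => hS₂sa r (hr r (hsub r hr')))
    (fun r hr' => hS₁ r (hsub r hr')) (fun r hr' => hS₂ r (hr r (hsub r hr')))
    (fun r hr' v => by
      linarith [hb₁ r ⟨hs.1.trans_le hr'.1, hr'.2⟩ v, hb₂ r ⟨hs.1.trans_le hr'.1, hr'.2⟩ v])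
  let e : E ≃ₗ[ℝ] E := LinearEquiv.ofBijective (H : E →ₗ[ℝ] E) hH
  have hker : (LinearMap.ker ((S₂ t - S₁ t : E →L[ℝ] E) : E →ₗ[ℝ] E)).map
      (e.symm : E →ₗ[ℝ] E) ≤ LinearMap.ker ((S₂ s - S₁ s : E →L[ℝ] E) : E →ₗ[ℝ] E) := by
    rintro _ ⟨w, hw, rfl⟩
    have hw : (S₂ t - S₁ t) w = 0 := hw
    have hHw : H (e.symm w) = w := e.apply_symm_apply w
    have h := hmono (e.symm w)
    rw [hHw, hw, inner_zero_left] at h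
    exact ((hS₂sa s (hr s hs)).sub (hS₁sa s hs)).apply_eq_zero_of_inner_eq_zero (hpos s hs)
      (le_antisymm h (hpos s hs _))
  calc _ = _ := (LinearEquiv.finrank_map_eq e.symm _).symm
    _ ≤ _ := Submodule.finrank_mono hker
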